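/- For every real K ≥ 1 there exists a constant C = C(K) ≥ 1 such that the following holds (Freiman's theorem). Let A be a finite nonempty set of integers with |A + A| ≤ K·|A|, where A + A = {a₁ + a₂ : a₁, a₂ ∈ A}. Then there exist a natural number r ≤ C, an integer h₀, integers u₁, …, u_r, and positive integers N₁, …, N_r such that A ⊆ {h₀ + n₁u₁ + ⋯ + n_r u_r : n_i ∈ ℤ, 0 ≤ n_i < N_i for each i} and N₁·N₂·⋯·N_r ≤ C·|A|. -/

import Mathlib

open Pointwise

open MeasureTheory Metric Module in
/-- Volume packing bound for separated sets in a finite-dimensional normed space. -/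
theorem card_le_pow_of_separated {E : Type*} [NormedAddCommGroup E] [NormedSpace ℝ E]
    [FiniteDimensional ℝ E] (T : Finset E) {δ ρ : ℝ} (hδ : 0 < δ) (hρ : δ ≤ ρ)
    (hT : ∀ x ∈ T, ‖x‖ ≤ ρ) (hsep : ∀ x ∈ T, ∀ y ∈ T, x ≠ y → δ ≤ ‖x - y‖) :
    (T.card : ℝ) ≤ (3 * ρ / δ) ^ finrank ℝ E := by
  borelize E
  let μ : Measure E := Measure.addHaar
  have hδ2 : 0 < δ / 2 := by positivity
  have hσ : 0 < ρ + δ / 2 := by linarith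
  have hdisj : Set.Pairwise (T : Set E)
      (Function.onFun Disjoint fun c => ball (c : E) (δ / 2)) := by
    rintro c hc d hd hcd
    apply ball_disjoint_ball
    rw [dist_eq_norm]
    linarith [hsep c hc d hd hcd]
  have hsub : (⋃ c ∈ T, ball (c : E) (δ / 2)) ⊆ ball (0 : E) (ρ + δ / 2) := by
    refine Set.iUnion₂_subset fun x hx => ball_subset_ball' ?_
    rw [dist_zero_right]
    linarith [hT x hx]
  have hvol : (T.card : ENNReal) * ENNReal.ofReal ((δ / 2) ^ finrank ℝ E) * μ (ball 0 1) ≤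
      ENNReal.ofReal ((ρ + δ / 2) ^ finrank ℝ E) * μ (ball 0 1) :=
    calc
      _ = μ (⋃ c ∈ T, ball (c : E) (δ / 2)) := by
        rw [measure_biUnion_finset hdisj fun c _ => measurableSet_ball]
        simp only [μ.addHaar_ball_of_pos _ hδ2, Finset.sum_const, nsmul_eq_mul, mul_assoc]
      _ ≤ μ (ball (0 : E) (ρ + δ / 2)) := measure_mono hsub
      _ = _ := by simp only [μ.addHaar_ball_of_pos _ hσ]
  have hcard := (ENNReal.mul_le_mul_iff_left (measure_ball_pos μ _ zero_lt_one).ne'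
    measure_ball_lt_top.ne).1 hvol
  have hreal := ENNReal.toReal_le_of_le_ofReal (pow_nonneg hσ.le _) hcard
  rw [ENNReal.toReal_mul, ENNReal.toReal_natCast,
    ENNReal.toReal_ofReal (pow_nonneg hδ2.le _)] at hreal
  calc (T.card : ℝ) ≤ (ρ + δ / 2) ^ finrank ℝ E / (δ / 2) ^ finrank ℝ E := by
        rwa [le_div_iff₀ (by positivity)]
    _ = ((ρ + δ / 2) / (δ / 2)) ^ finrank ℝ E := (div_pow _ _ _).symm
    _ ≤ _ := by
      refine pow_le_pow_left₀ (by positivity) ?_ _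
      rw [div_le_div_iff₀ hδ2 hδ]
      nlinarith

/-- A finite subset of a metric space has a `δ`-separated subset that is also a `δ`-net. -/
theorem exists_separated_net {E : Type*} [NormedAddCommGroup E] (S : Finset E) {δ : ℝ}
    (hδ : 0 < δ) : ∃ T ⊆ S, (∀ x ∈ T, ∀ y ∈ T, x ≠ y → δ ≤ ‖x - y‖) ∧
      ∀ x ∈ S, ∃ y ∈ T, ‖x - y‖ < δ := by
  classical
  obtain ⟨T, hT⟩ := (S.powerset.filter fun T =>
    ∀ x ∈ T, ∀ y ∈ T, x ≠ y → δ ≤ ‖x - y‖).exists_maximal ⟨∅, by simp⟩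
  have hTm := hT.1
  simp only [Finset.mem_filter, Finset.mem_powerset] at hTm
  refine ⟨T, hTm.1, hTm.2, fun x hx => ?_⟩
  by_contra! h
  have hxT : x ∉ T := fun hxT => by
    have := h x hxT
    simp at this
    linarith
  refine hxT (hT.2 (y := insert x T) ?_ (Finset.subset_insert _ _) (Finset.mem_insert_self _ _))
  simp only [Finset.mem_filter, Finset.mem_powerset]
  refine ⟨Finset.insert_subset hx hTm.1, ?_⟩
  intro a ha b hb hab
  rw [Finset.mem_insert] at ha hb
  rcases ha with rfl | ha <;> rcases hb with rfl | hb
  · exact absurd rfl hab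
  · exact h b hb
  · rw [norm_sub_rev]; exact h a ha
  · exact hTm.2 a ha b hb hab

open Module in
/-- Points of a discrete subgroup in a ball of a subspace, compared with those in a smaller
ball. -/
theorem card_le_pow_mul_card_of_subspace {E : Type*} [NormedAddCommGroup E] [NormedSpace ℝ E]
    (L : AddSubgroup E) (W : Submodule ℝ E) [FiniteDimensional ℝ W] (S S' : Finset E) {δ ρ : ℝ}
    (hδ : 0 < δ) (hρ : δ ≤ ρ) (hSL : ∀ x ∈ S, x ∈ L) (hSW : ∀ x ∈ S, x ∈ W)
    (hS : ∀ x ∈ S, ‖x‖ ≤ ρ) (hS' : ∀ x ∈ L, ‖x‖ < δ → x ∈ S') :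
    (S.card : ℝ) ≤ (3 * ρ / δ) ^ finrank ℝ W * S'.card := by
  classical
  obtain ⟨T, hTS, hsep, hnet⟩ := exists_separated_net S hδ
  have hT : (T.card : ℝ) ≤ (3 * ρ / δ) ^ finrank ℝ W := by
    have := card_le_pow_of_separated (T.subtype (· ∈ W)) hδ hρ
      (fun x hx => hS _ (hTS (Finset.mem_subtype.1 hx)))
      (fun x hx y hy hxy => hsep _ (Finset.mem_subtype.1 hx) _ (Finset.mem_subtype.1 hy)
        (fun h => hxy (Subtype.ext h)))
    rwa [Finset.card_subtype, Finset.filter_true_of_mem fun x hx => hSW x (hTS hx)] at this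
  have hcov : S ⊆ T + S' := fun x hx => by
    obtain ⟨y, hy, hxy⟩ := hnet x hx
    exact Finset.mem_add.2 ⟨y, hy, x - y,
      hS' _ (L.sub_mem (hSL _ hx) (hSL _ (hTS hy))) hxy, by abel⟩
  have hc : (S.card : ℝ) ≤ T.card * S'.card := by
    exact_mod_cast (Finset.card_le_card hcov).trans (Finset.card_add_le)
  exact hc.trans (by gcongr)

open Module in
/-- A weak form of Minkowski's second theorem: short linearly independent vectors of a discrete
group, the product of whose lengths is controlled by the number of points in a ball. -/
theorem exists_short_linearIndependent {E : Type*} [NormedAddCommGroup E] [NormedSpace ℝ E]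
    [FiniteDimensional ℝ E] (L : AddSubgroup E) (hfin : ∀ ρ : ℝ, {v | v ∈ L ∧ ‖v‖ ≤ ρ}.Finite)
    (hdisc : ∀ v ∈ L, ‖v‖ < 1 → v = 0) {ρ : ℝ} (hρ : 1 ≤ ρ) :
    ∃ (k : ℕ) (b : Fin k → E), k ≤ finrank ℝ E ∧ LinearIndependent ℝ b ∧
      (∀ i, b i ∈ L ∧ ‖b i‖ ≤ ρ) ∧
      ((hfin ρ).toFinset.card : ℝ) * ∏ i, ‖b i‖ ≤
        (3 ^ finrank ℝ E) ^ (finrank ℝ E + 1) * ρ ^ k := by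
  classical
  set d := finrank ℝ E with hd
  set D : ℝ := 3 ^ d with hD
  have hD1 : 1 ≤ D := one_le_pow₀ (by norm_num)
  by_contra! hcon
  have key : ∀ k : ℕ, ∃ (b : Fin k → E) (δ : ℝ), LinearIndependent ℝ b ∧ 0 < δ ∧ δ ≤ ρ ∧
      (∀ i, b i ∈ L ∧ ‖b i‖ ≤ δ) ∧
      (∀ v ∈ L, ‖v‖ < δ → v ∈ Submodule.span ℝ (Set.range b)) ∧
      (((hfin δ).toFinset.filter (‖·‖ < δ)).card : ℝ) * ∏ i, ‖b i‖ ≤ D ^ k * δ ^ k := by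
    intro k
    induction k with
    | zero =>
      refine ⟨Fin.elim0, 1, linearIndependent_empty_type, one_pos, hρ, fun i => i.elim0,
        fun v hv hv1 => by rw [hdisc v hv hv1]; exact Submodule.zero_mem _, ?_⟩
      have : (hfin 1).toFinset.filter (‖·‖ < 1) ⊆ {0} := by
        intro v hv
        simp only [Finset.mem_filter, Set.Finite.mem_toFinset, Set.mem_ofPred_eq] at hv
        simpa using hdisc v hv.1.1 hv.2
      have := Finset.card_le_card this
      simpa using this
    | succ k ih =>
      obtain ⟨b, δ, hli, hδ, hδρ, hb, hspan, hcard⟩ := ih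
      set W := Submodule.span ℝ (Set.range b) with hW
      have hWk : finrank ℝ W = k := by
        rw [hW, finrank_span_eq_card hli, Fintype.card_fin]
      have hkd : k ≤ d := by rw [← hWk]; exact Submodule.finrank_le W
      have hD3 : (3 : ℝ) ^ k ≤ D := pow_le_pow_right₀ (by norm_num) hkd
      -- enlarging the radius inside `W`
      have grow : ∀ S : Finset E, ∀ r, δ ≤ r → (∀ x ∈ S, x ∈ L) → (∀ x ∈ S, x ∈ W) →
          (∀ x ∈ S, ‖x‖ ≤ r) → (S.card : ℝ) * ∏ i, ‖b i‖ ≤ D ^ (k + 1) * r ^ k := by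
        intro S r hr hSL hSW hS
        have h1 := card_le_pow_mul_card_of_subspace L W S ((hfin δ).toFinset.filter (‖·‖ < δ))
          hδ hr hSL hSW hS (fun x hx hxδ => by simp [hx, hxδ, hxδ.le])
        rw [hWk] at h1
        have hr0 : 0 < r := hδ.trans_le hr
        calc (S.card : ℝ) * ∏ i, ‖b i‖
            ≤ ((3 * r / δ) ^ k * ((hfin δ).toFinset.filter (‖·‖ < δ)).card) * ∏ i, ‖b i‖ := by
              gcongr
          _ = (3 * r / δ) ^ k *
              (((hfin δ).toFinset.filter (‖·‖ < δ)).card * ∏ i, ‖b i‖) := by ring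
          _ ≤ (3 * r / δ) ^ k * (D ^ k * δ ^ k) := by gcongr
          _ = 3 ^ k * (D ^ k * r ^ k) := by
              rw [div_pow, mul_pow]; field_simp
          _ ≤ D * (D ^ k * r ^ k) := by gcongr
          _ = _ := by ring
      by_cases hT : ∃ v ∈ L, ‖v‖ ≤ ρ ∧ v ∉ W
      · obtain ⟨v₀, hv₀L, hv₀ρ, hv₀W⟩ := hT
        obtain ⟨v, hv, hmin⟩ := ((hfin ρ).toFinset.filter (· ∉ W)).exists_min_image (‖·‖)
          ⟨v₀, by simp [hv₀L, hv₀ρ, hv₀W]⟩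
        simp only [Finset.mem_filter, Set.Finite.mem_toFinset, Set.mem_ofPred_eq] at hv hmin
        obtain ⟨⟨hvL, hvρ⟩, hvW⟩ := hv
        have hδv : δ ≤ ‖v‖ := by
          by_contra! h
          exact hvW (hspan v hvL h)
        have hlt : ∀ w ∈ L, ‖w‖ < ‖v‖ → w ∈ W := by
          intro w hw hwv
          by_contra hwW
          exact absurd (hmin w ⟨⟨hw, hwv.le.trans hvρ⟩, hwW⟩) (not_le.2 hwv)
        refine ⟨Fin.cons v b, ‖v‖, linearIndependent_finCons.2 ⟨hli, hvW⟩, hδ.trans_le hδv, hvρ,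
          ?_, ?_, ?_⟩
        · intro i
          refine Fin.cases ?_ (fun j => ?_) i
          · simp [hvL]
          · simpa using ⟨(hb j).1, (hb j).2.trans hδv⟩
        · intro w hw hwv
          refine Submodule.span_mono ?_ (hlt w hw hwv)
          rw [Fin.range_cons]
          exact Set.subset_insert _ _
        · have := grow ((hfin ‖v‖).toFinset.filter (‖·‖ < ‖v‖)) ‖v‖ hδv
            (fun x hx => by simp at hx; exact hx.1.1)
            (fun x hx => by simp at hx; exact hlt x hx.1.1 hx.2)
            (fun x hx => by simp at hx; exact hx.1.2)
          rw [Fin.prod_univ_succ]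
          simp only [Fin.cons_zero, Fin.cons_succ]
          calc _ = ((((hfin ‖v‖).toFinset.filter (‖·‖ < ‖v‖)).card : ℝ) * ∏ i, ‖b i‖) * ‖v‖ := by
                ring
            _ ≤ D ^ (k + 1) * ‖v‖ ^ k * ‖v‖ := by gcongr
            _ = _ := by ring
      · push Not at hT
        exfalso
        refine absurd (hcon k b hkd hli fun i => ⟨(hb i).1, (hb i).2.trans hδρ⟩) (not_lt.2 ?_)
        refine (grow (hfin ρ).toFinset ρ hδρ (fun x hx => by simp at hx; exact hx.1)
          (fun x hx => by simp at hx; exact hT x hx.1 hx.2)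
          (fun x hx => by simp at hx; exact hx.2)).trans ?_
        have : D ^ (k + 1) ≤ D ^ (d + 1) := pow_le_pow_right₀ hD1 (by omega)
        gcongr
  obtain ⟨b, δ, hli, -⟩ := key (d + 1)
  have := hli.fintype_card_le_finrank
  simp at this
  omega

/-- The Bohr set of frequency set `R` and width `1/4` in `ZMod N`. -/
def IsBohr {N : ℕ} (R : Finset (ZMod N)) (y : ZMod N) : Prop :=
  ∀ r ∈ R, ∃ m : ℤ, (m : ZMod N) = r * y ∧ 4 * |(m : ℝ)| ≤ N

theorem re_stdAddChar_nonneg {N : ℕ} [NeZero N] (m : ℤ) (hm : 4 * |(m : ℝ)| ≤ N) :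
    0 ≤ (ZMod.stdAddChar (m : ZMod N)).re := by
  have hN : (0 : ℝ) < N := by exact_mod_cast NeZero.pos N
  rw [ZMod.stdAddChar_coe]
  have h : (2 * Real.pi * Complex.I * m / N : ℂ) = ((2 * Real.pi * m / N : ℝ) : ℂ) * Complex.I := by
    push_cast; ring
  rw [h, Complex.exp_ofReal_mul_I_re]
  have h2 : |2 * Real.pi * m / N| ≤ Real.pi / 2 := by
    rw [abs_div, abs_mul, abs_of_pos hN, abs_of_pos Real.two_pi_pos, div_le_iff₀ hN]
    nlinarith [Real.pi_pos]
  exact Real.cos_nonneg_of_neg_pi_div_two_le_of_le (abs_le.1 h2).1 (abs_le.1 h2).2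

/-- The Fourier transform of the indicator function of a finite set. -/
noncomputable def indicatorDft {N : ℕ} [NeZero N] (B : Finset (ZMod N)) (r : ZMod N) : ℂ :=
  ∑ b ∈ B, ZMod.stdAddChar (r * b)

section Fourier
variable {N : ℕ} [NeZero N] (B : Finset (ZMod N))

theorem conj_indicatorDft (r : ZMod N) :
    (starRingEnd ℂ) (indicatorDft B r) = ∑ b ∈ B, ZMod.stdAddChar (r * -b) := by
  rw [indicatorDft, map_sum]
  refine Finset.sum_congr rfl fun b _ => ?_
  rw [mul_neg, AddChar.map_neg_eq_conj]

theorem sum_stdAddChar_mul (t : ZMod N) :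
    ∑ r : ZMod N, ZMod.stdAddChar (r * t) = if t = 0 then (N : ℂ) else 0 := by
  rw [AddChar.sum_mulShift t (ZMod.isPrimitive_stdAddChar N), ZMod.card]
  split_ifs <;> simp

theorem sum_normSq_indicatorDft :
    ∑ r : ZMod N, Complex.normSq (indicatorDft B r) = N * B.card := by
  have h : ∑ r : ZMod N, (Complex.normSq (indicatorDft B r) : ℂ) = N * B.card := by
    simp_rw [Complex.normSq_eq_conj_mul_self, conj_indicatorDft, indicatorDft,
      Finset.sum_mul_sum, ← AddChar.map_add_eq_mul, ← mul_add]
    rw [Finset.sum_comm]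
    simp_rw [Finset.sum_comm (s := Finset.univ) (t := B), sum_stdAddChar_mul, neg_add_eq_zero]
    simp [mul_comm]
  exact_mod_cast h

theorem sum_normSq_sq_mul_re_eq_zero {y : ZMod N}
    (hy : ∀ a ∈ B, ∀ b ∈ B, ∀ c ∈ B, ∀ d ∈ B, a + b - c - d ≠ y) :
    ∑ r : ZMod N, Complex.normSq (indicatorDft B r) ^ 2 * (ZMod.stdAddChar (r * y)).re = 0 := by
  have h : ∑ r : ZMod N, (Complex.normSq (indicatorDft B r) : ℂ) ^ 2 *
      ZMod.stdAddChar (r * y) = 0 := by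
    have h1 : ∀ r : ZMod N, (Complex.normSq (indicatorDft B r) : ℂ) ^ 2 *
        ZMod.stdAddChar (r * y) = ∑ a ∈ B, ∑ b ∈ B, ∑ c ∈ B, ∑ d ∈ B,
          ZMod.stdAddChar (r * (b + d - a - c + y)) := by
      intro r
      have : (Complex.normSq (indicatorDft B r) : ℂ) ^ 2 =
          ((starRingEnd ℂ) (indicatorDft B r) * (starRingEnd ℂ) (indicatorDft B r)) *
          (indicatorDft B r * indicatorDft B r) := by
        rw [Complex.normSq_eq_conj_mul_self]; ring
      rw [this, conj_indicatorDft, indicatorDft]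
      simp_rw [Finset.sum_mul_sum, Finset.sum_mul]
      refine Finset.sum_congr rfl fun a _ => Finset.sum_congr rfl fun b _ =>
        Finset.sum_congr rfl fun c _ => Finset.sum_congr rfl fun d _ => ?_
      simp_rw [← AddChar.map_add_eq_mul]
      congr 1
      ring
    simp_rw [h1]
    rw [Finset.sum_comm]
    refine Finset.sum_eq_zero fun a ha => ?_
    rw [Finset.sum_comm]
    refine Finset.sum_eq_zero fun b hb => ?_
    rw [Finset.sum_comm]
    refine Finset.sum_eq_zero fun c hc => ?_
    rw [Finset.sum_comm]
    refine Finset.sum_eq_zero fun d hd => ?_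
    rw [sum_stdAddChar_mul, if_neg]
    intro h0
    apply hy a ha c hc b hb d hd
    linear_combination -h0
  have h2 := congrArg Complex.re h
  rw [Complex.re_sum, Complex.zero_re] at h2
  rw [← h2]
  refine Finset.sum_congr rfl fun r _ => ?_
  rw [← Complex.ofReal_pow, Complex.re_ofReal_mul]

/-- **Bogolyubov's lemma**: if `B` is dense in `ZMod N` then `2B - 2B` contains a Bohr set of
bounded rank. -/
theorem bogolyubov (hB : B.Nonempty) {c : ℝ} (hc : (N : ℝ) ≤ c * B.card) :
    ∃ R : Finset (ZMod N), 1 ∈ R ∧ (R.card : ℝ) ≤ 2 * c ^ 2 + 1 ∧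
      ∀ y, IsBohr R y → ∃ a ∈ B, ∃ b ∈ B, ∃ c ∈ B, ∃ d ∈ B, a + b - c - d = y := by
  classical
  have hN : (0 : ℝ) < N := by exact_mod_cast NeZero.pos N
  set β : ℝ := (B.card : ℝ) with hβ
  have hβ0 : 0 < β := by rw [hβ]; exact_mod_cast hB.card_pos
  have hβN : β ≤ N := by
    rw [hβ]; exact_mod_cast (Finset.card_le_univ B).trans_eq (ZMod.card N)
  set F : ZMod N → ℝ := fun r => Complex.normSq (indicatorDft B r) with hF
  have hF0 : ∀ r, 0 ≤ F r := fun r => Complex.normSq_nonneg _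
  have hsum : ∑ r, F r = N * β := sum_normSq_indicatorDft B
  have hFz : F 0 = β ^ 2 := by
    simp [hF, indicatorDft, hβ, sq]
  set R₀ : Finset (ZMod N) := Finset.univ.filter fun r => β ^ 3 ≤ 2 * N * F r with hR₀
  refine ⟨insert 1 R₀, Finset.mem_insert_self _ _, ?_, ?_⟩
  · have h1 : (R₀.card : ℝ) * β ^ 3 ≤ 2 * N * (N * β) := by
      rw [← hsum, Finset.mul_sum, ← nsmul_eq_mul]
      calc _ ≤ ∑ r ∈ R₀, 2 * N * F r :=
            Finset.card_nsmul_le_sum _ _ _ fun r hr => (Finset.mem_filter.1 hr).2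
        _ ≤ _ := Finset.sum_le_sum_of_subset_of_nonneg (Finset.subset_univ _)
            fun r _ _ => by have := hF0 r; positivity
    have h2 : (R₀.card : ℝ) * β ^ 3 ≤ (2 * c ^ 2) * β ^ 3 := by
      have : (N : ℝ) ^ 2 ≤ (c * β) ^ 2 := by gcongr
      nlinarith
    have h3 := le_of_mul_le_mul_right h2 (by positivity)
    have h4 : ((insert 1 R₀).card : ℝ) ≤ R₀.card + 1 := by
      exact_mod_cast Finset.card_insert_le _ _
    linarith
  · intro y hy
    by_contra! hcon
    have h0 := sum_normSq_sq_mul_re_eq_zero B hcon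
    have hlow : ∀ r : ZMod N, (if r = 0 then β ^ 4 else 0) - β ^ 3 / (2 * N) * F r ≤
        F r ^ 2 * (ZMod.stdAddChar (r * y)).re - (if r = 0 then β ^ 3 / (2 * N) * F r else 0) := by
      intro r
      by_cases hr : r = 0
      · subst hr
        simp [hFz]
        ring_nf
        rfl
      · simp only [hr, if_false, zero_sub, sub_zero]
        by_cases hrR : r ∈ R₀
        · obtain ⟨m, hm, hm4⟩ := hy r (Finset.mem_insert_of_mem hrR)
          have := re_stdAddChar_nonneg m hm4
          rw [hm] at this
          have h5 : 0 ≤ β ^ 3 / (2 * N) * F r := by have := hF0 r; positivity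
          have h6 : 0 ≤ F r ^ 2 * (ZMod.stdAddChar (r * y)).re := by positivity
          linarith
        · have hlt : 2 * N * F r < β ^ 3 := by
            simpa [hR₀] using hrR
          have h7 : F r ≤ β ^ 3 / (2 * N) := by
            rw [le_div_iff₀ (by positivity)]; linarith
          have h8 : -1 ≤ (ZMod.stdAddChar (r * y)).re := by
            have h9 := Complex.abs_re_le_norm (ZMod.stdAddChar (r * y))
            rw [AddChar.norm_apply] at h9
            exact (abs_le.1 h9).1
          have := hF0 r
          nlinarith [mul_le_mul_of_nonneg_right h7 this, sq_nonneg (F r)]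
    have hs := Finset.sum_le_sum fun r (_ : r ∈ Finset.univ) => hlow r
    rw [Finset.sum_sub_distrib, Finset.sum_sub_distrib, h0, ← Finset.mul_sum, hsum,
      Finset.sum_ite_eq', Finset.sum_ite_eq'] at hs
    simp only [Finset.mem_univ, if_true, hFz] at hs
    have h10 : β ^ 3 / (2 * N) * (N * β) = β ^ 4 / 2 := by field_simp
    have h11 : 0 ≤ β ^ 3 / (2 * N) * β ^ 2 := by positivity
    have : 0 < β ^ 4 := by positivity
    linarith

end Fourier

/-- The lattice of integer vectors congruent to a multiple of the vector of frequencies `R`. -/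
def bohrLattice {N : ℕ} (R : Finset (ZMod N)) : AddSubgroup (R → ℝ) where
  carrier := {v | ∃ y : ZMod N, ∀ i : R, ∃ m : ℤ, v i = m ∧ (m : ZMod N) = i * y}
  zero_mem' := ⟨0, fun i => ⟨0, by simp, by simp⟩⟩
  add_mem' := by
    rintro v w ⟨y, hy⟩ ⟨z, hz⟩
    refine ⟨y + z, fun i => ?_⟩
    obtain ⟨m, hm, hm'⟩ := hy i
    obtain ⟨n, hn, hn'⟩ := hz i
    exact ⟨m + n, by simp [hm, hn], by push_cast; rw [hm', hn']; ring⟩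
  neg_mem' := by
    rintro v ⟨y, hy⟩
    refine ⟨-y, fun i => ?_⟩
    obtain ⟨m, hm, hm'⟩ := hy i
    exact ⟨-m, by simp [hm], by push_cast; rw [hm']; ring⟩

section BohrLattice
variable {N : ℕ} (R : Finset (ZMod N))

theorem mem_bohrLattice {v : R → ℝ} : v ∈ bohrLattice R ↔
    ∃ y : ZMod N, ∀ i : R, ∃ m : ℤ, v i = m ∧ (m : ZMod N) = i * y := Iff.rfl

theorem bohrLattice_finite (ρ : ℝ) : {v | v ∈ bohrLattice R ∧ ‖v‖ ≤ ρ}.Finite := by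
  classical
  refine ((Fintype.piFinset fun _ : R => Finset.Icc (-⌈ρ⌉) ⌈ρ⌉).image
    fun m i => (m i : ℝ)).finite_toSet.subset ?_
  rintro v ⟨⟨y, hy⟩, hv⟩
  choose m hm _ using hy
  rw [Finset.mem_coe, Finset.mem_image]
  refine ⟨m, ?_, funext fun i => (hm i).symm⟩
  rw [Fintype.mem_piFinset]
  intro i
  have h1 : |(m i : ℝ)| ≤ ρ := by
    rw [← hm i, ← Real.norm_eq_abs]
    exact (norm_le_pi_norm v i).trans hv
  have h2 : |(m i : ℝ)| ≤ ⌈ρ⌉ := h1.trans (Int.le_ceil ρ)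
  rw [Finset.mem_Icc, ← abs_le]
  exact_mod_cast h2

theorem eq_zero_of_mem_bohrLattice (v : R → ℝ) (hv : v ∈ bohrLattice R) (h : ‖v‖ < 1) : v = 0 := by
  obtain ⟨y, hy⟩ := hv
  funext i
  obtain ⟨m, hm, _⟩ := hy i
  have h1 : |(m : ℝ)| < 1 := by
    rw [← hm, ← Real.norm_eq_abs]
    exact (norm_le_pi_norm v i).trans_lt h
  have h2 : m = 0 := Int.abs_lt_one_iff.1 (by exact_mod_cast h1)
  simp [hm, h2]

theorem card_bohrLattice_ball [NeZero N] (hR : 1 ∈ R) :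
    (N : ℝ) ≤ 4 ^ R.card * (bohrLattice_finite R (N / 4)).toFinset.card := by
  classical
  have hN : 0 < N := NeZero.pos N
  let f : ZMod N → (R → Fin 4) := fun y i =>
    ⟨4 * ((i : ZMod N) * y).val / N, by
      rw [Nat.div_lt_iff_lt_mul hN]
      have := ZMod.val_lt ((i : ZMod N) * y)
      omega⟩
  obtain ⟨t, -, ht⟩ := Finset.exists_le_card_fiber_of_nsmul_le_card_of_maps_to
    (s := (Finset.univ : Finset (ZMod N))) (t := (Finset.univ : Finset (R → Fin 4))) (f := f)
    (b := (N : ℝ) / 4 ^ R.card) (fun _ _ => Finset.mem_univ _) Finset.univ_nonempty (by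
      simp [Finset.card_univ, ZMod.card]
      field_simp
      rfl)
  rw [div_le_iff₀ (by positivity), mul_comm] at ht
  refine ht.trans ?_
  gcongr
  set S := Finset.univ.filter fun y => f y = t with hS
  rcases S.eq_empty_or_nonempty with he | ⟨y₀, hy₀⟩
  · simp [he]
  refine Finset.card_le_card_of_injOn
    (fun y i => ((((i : ZMod N) * y).val : ℤ) - (((i : ZMod N) * y₀).val : ℤ) : ℤ)) ?_ ?_
  · intro y hy
    simp only [Set.Finite.coe_toFinset, Set.mem_ofPred_eq]
    refine ⟨⟨y - y₀, fun i => ⟨_, rfl, ?_⟩⟩, ?_⟩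
    · push_cast
      simp [mul_sub]
    · rw [pi_norm_le_iff_of_nonneg (by positivity)]
      intro i
      have hf : f y = f y₀ := by
        rw [hS, Finset.mem_coe, Finset.mem_filter] at hy
        rw [hS, Finset.mem_filter] at hy₀
        rw [hy.2, hy₀.2]
      have hfi := congrArg Fin.val (congrFun hf i)
      simp only [f] at hfi
      have h1 := Nat.div_add_mod (4 * ((i : ZMod N) * y).val) N
      have h2 := Nat.div_add_mod (4 * ((i : ZMod N) * y₀).val) N
      rw [← hfi] at h2
      have h3 := Nat.mod_lt (4 * ((i : ZMod N) * y).val) hN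
      have h4 := Nat.mod_lt (4 * ((i : ZMod N) * y₀).val) hN
      have h5 : 4 * |(((i : ZMod N) * y).val : ℤ) - (((i : ZMod N) * y₀).val : ℤ)| ≤ N := by
        have : (4 * |(((i : ZMod N) * y).val : ℤ) - (((i : ZMod N) * y₀).val : ℤ)|) =
          |4 * ((((i : ZMod N) * y).val : ℤ) - (((i : ZMod N) * y₀).val : ℤ))| := by
          rw [abs_mul]; rfl
        rw [this, abs_le]
        constructor <;> omega
      rw [Real.norm_eq_abs, le_div_iff₀ (by norm_num), mul_comm]
      exact_mod_cast h5
  · intro y _ z _ hyz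
    have := congrFun hyz ⟨1, hR⟩
    simp only [one_mul, Int.cast_inj, sub_left_inj, Nat.cast_inj] at this
    exact ZMod.val_injective N this

/-- A Bohr set contains a large proper generalised arithmetic progression of bounded rank. -/
theorem exists_proper_progression_of_isBohr (hN : 4 ≤ N) (hR : 1 ∈ R) :
    ∃ (k : ℕ) (x : Fin k → ZMod N) (M : Fin k → ℕ), k ≤ R.card ∧ (∀ i, 0 < M i) ∧
      (∀ i, IsBohr R (x i)) ∧
      (∀ n : Fin k → ℕ, (∀ i, n i < M i) → IsBohr R (∑ i, n i * x i)) ∧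
      (∀ n n' : Fin k → ℕ, (∀ i, n i < M i) → (∀ i, n' i < M i) →
        ∑ i, n i * x i = ∑ i, n' i * x i → n = n') ∧
      (N : ℝ) ≤ 4 ^ R.card * ((3 ^ R.card) ^ (R.card + 1) * (R.card + 1) ^ R.card) *
        ∏ i, (M i : ℝ) := by
  classical
  have : NeZero N := ⟨by omega⟩
  have hN' : (4 : ℝ) ≤ N := by exact_mod_cast hN
  obtain ⟨k, b, hk, hli, hb, hcard⟩ := exists_short_linearIndependent (bohrLattice R)
    (bohrLattice_finite R) (eq_zero_of_mem_bohrLattice R) (ρ := (N : ℝ) / 4) (by linarith)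
  rw [Module.finrank_fintype_fun_eq_card, Fintype.card_coe] at hk hcard
  have hpos : ∀ i, 0 < ‖b i‖ := fun i => norm_pos_iff.2 (hli.ne_zero i)
  have hb' := fun i => (mem_bohrLattice R).1 (hb i).1
  choose x m hm hmx using hb'
  set M : Fin k → ℕ := fun i => ⌊(N : ℝ) / 4 / ((k : ℝ) * ‖b i‖)⌋₊ + 1 with hM
  have hMle : ∀ (n : Fin k → ℕ), (∀ i, n i < M i) → ∀ i, n i * ‖b i‖ ≤ (N : ℝ) / 4 / k := by
    intro n hn i
    have hk0 : (0 : ℝ) < k := by exact_mod_cast i.pos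
    have h1 : (n i : ℝ) ≤ (N : ℝ) / 4 / ((k : ℝ) * ‖b i‖) :=
      (Nat.le_floor_iff (by positivity)).1 (Nat.lt_succ_iff.1 (hn i))
    rw [← div_div, le_div_iff₀ (hpos i)] at h1
    exact h1
  have hcoord : ∀ (n : Fin k → ℕ), (∀ i, n i < M i) → ∀ r : R,
      4 * |((∑ i, n i * m i r : ℤ) : ℝ)| ≤ N := by
    intro n hn r
    have h1 : |((∑ i, n i * m i r : ℤ) : ℝ)| ≤ N / 4 := by
      push_cast
      calc |∑ i, (n i : ℝ) * m i r| ≤ ∑ i, |(n i : ℝ) * m i r| := Finset.abs_sum_le_sum_abs _ _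
        _ ≤ ∑ i : Fin k, (N : ℝ) / 4 / k := by
          refine Finset.sum_le_sum fun i _ => le_trans ?_ (hMle n hn i)
          rw [abs_mul, Nat.abs_cast, ← hm, ← Real.norm_eq_abs]
          gcongr
          exact norm_le_pi_norm (b i) r
        _ ≤ N / 4 := by
          rw [Finset.sum_const, Finset.card_univ, Fintype.card_fin, nsmul_eq_mul]
          rcases Nat.eq_zero_or_pos k with h | h
          · simp only [h, Nat.cast_zero, zero_mul]; positivity
          · have : (k : ℝ) ≠ 0 := by positivity
            rw [mul_div_cancel₀ _ this]
    linarith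
  have hcast : ∀ (n : Fin k → ℕ) (r : R),
      ((∑ i, n i * m i r : ℤ) : ZMod N) = r * ∑ i, n i * x i := by
    intro n r
    push_cast
    rw [Finset.mul_sum]
    refine Finset.sum_congr rfl fun i _ => ?_
    rw [hmx]; ring
  refine ⟨k, x, M, hk, fun i => Nat.succ_pos _, ?_, ?_, ?_, ?_⟩
  · intro i r hr
    refine ⟨m i ⟨r, hr⟩, hmx i ⟨r, hr⟩, ?_⟩
    have := (norm_le_pi_norm (b i) ⟨r, hr⟩).trans (hb i).2
    rw [hm, Real.norm_eq_abs] at this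
    linarith
  · exact fun n hn r hr => ⟨_, hcast n ⟨r, hr⟩, hcoord n hn ⟨r, hr⟩⟩
  · intro n n' hn hn' h
    have hcoords : ∀ r : R, ∑ i, (n i : ℤ) * m i r = ∑ i, (n' i : ℤ) * m i r := by
      intro r
      have h1 : ((∑ i, n i * m i r : ℤ) : ZMod N) = ((∑ i, n' i * m i r : ℤ) : ZMod N) := by
        rw [hcast, hcast, h]
      rw [ZMod.intCast_eq_intCast_iff_dvd_sub] at h1
      have h2 := hcoord n hn r
      have h3 := hcoord n' hn' r
      have h4 : 4 * |∑ i, (n i : ℤ) * m i r| ≤ N := by exact_mod_cast h2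
      have h5 : 4 * |∑ i, (n' i : ℤ) * m i r| ≤ N := by exact_mod_cast h3
      have h6 := Int.eq_zero_of_abs_lt_dvd h1 (by
        have := abs_sub (∑ i, (n' i : ℤ) * m i r) (∑ i, (n i : ℤ) * m i r)
        omega)
      omega
    have hvec : ∑ i, ((n i : ℝ) - n' i) • b i = 0 := by
      funext r
      have := hcoords r
      simp only [sub_smul, Finset.sum_sub_distrib, Pi.sub_apply, Finset.sum_apply, Pi.smul_apply,
        smul_eq_mul, Pi.zero_apply, sub_eq_zero, hm]
      exact_mod_cast this
    funext i
    have := Fintype.linearIndependent_iff.1 hli _ hvec i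
    exact_mod_cast sub_eq_zero.1 this
  · have hprod : 0 < ∏ i, ‖b i‖ := Finset.prod_pos fun i _ => hpos i
    have hMprod : ((N : ℝ) / 4) ^ k ≤ (R.card + 1) ^ R.card * (∏ i, (M i : ℝ)) * ∏ i, ‖b i‖ := by
      have h1 : ∏ _i : Fin k, ((N : ℝ) / 4) ≤ ∏ i : Fin k, (k * (M i : ℝ) * ‖b i‖) := by
        refine Finset.prod_le_prod (fun _ _ => by positivity) fun i _ => ?_
        have hk0 : (0 : ℝ) < k := by exact_mod_cast i.pos
        have := (Nat.lt_floor_add_one ((N : ℝ) / 4 / ((k : ℝ) * ‖b i‖))).le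
        rw [div_le_iff₀ (mul_pos hk0 (hpos i))] at this
        simp only [hM]
        push_cast
        linarith
      rw [Finset.prod_mul_distrib, Finset.prod_mul_distrib, Finset.prod_const, Finset.prod_const,
        Finset.card_univ, Fintype.card_fin] at h1
      refine h1.trans ?_
      gcongr
      calc (k : ℝ) ^ k ≤ (R.card + 1) ^ k := by
            gcongr
            have : (k : ℝ) ≤ R.card := by exact_mod_cast hk
            linarith
        _ ≤ _ := pow_le_pow_right₀ (by linarith [Nat.cast_nonneg (α := ℝ) R.card]) hk
    have h2 := card_bohrLattice_ball R hR
    set D : ℝ := (3 ^ R.card) ^ (R.card + 1)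
    have hD : 0 ≤ D := by positivity
    refine h2.trans ?_
    rw [mul_assoc]
    gcongr
    refine le_of_mul_le_mul_right (hcard.trans ?_) hprod
    calc D * ((N : ℝ) / 4) ^ k ≤ D * _ := mul_le_mul_of_nonneg_left hMprod hD
      _ = _ := by ring

end BohrLattice

theorem sum_fin_mem_nsmul {A : Finset ℤ} {m : ℕ} {s : Fin m → ℤ} (hs : ∀ i, s i ∈ A) :
    ∑ i, s i ∈ m • A := by
  rw [Finset.mem_nsmul]
  exact ⟨fun i => ⟨s i, hs i⟩, by simp [List.sum_ofFn]⟩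

/-- A dilation modulo `p` whose residues of the nonzero elements of `X` avoid the multiples
of `N`. -/
theorem exists_dilation {p : ℕ} [Fact p.Prime] {N : ℕ} (X : Finset ℤ) (hX : X.card < N)
    (hp : ∀ x ∈ X, x ≠ 0 → (x : ZMod p) ≠ 0) :
    ∃ q : ZMod p, ∀ x ∈ X, x ≠ 0 → ¬ N ∣ (q * (x : ZMod p)).val := by
  classical
  have hp2 := (Fact.out : p.Prime).two_le
  have hN : 0 < N := by omega
  by_contra! hcon
  set bad : ℤ → Finset (ZMod p) := fun x =>
    Finset.univ.filter fun q => q ≠ 0 ∧ N ∣ (q * (x : ZMod p)).val with hbad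
  have hsub : Finset.univ.erase (0 : ZMod p) ⊆ (X.filter (· ≠ 0)).biUnion bad := by
    intro q hq
    obtain ⟨x, hx, hx0, hd⟩ := hcon q
    rw [Finset.mem_biUnion]
    exact ⟨x, by simp [hx, hx0], by simp [hbad, hd, Finset.ne_of_mem_erase hq]⟩
  have hcard : ∀ x ∈ X.filter (· ≠ 0), (bad x).card ≤ (p - 1) / N := by
    intro x hx
    rw [Finset.mem_filter] at hx
    have hx0 := hp x hx.1 hx.2
    rw [← Nat.Ioc_filter_dvd_card_eq_div]
    refine Finset.card_le_card_of_injOn (fun q => (q * (x : ZMod p)).val) ?_ ?_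
    · intro q hq
      simp only [hbad, Finset.coe_filter, Finset.mem_univ, true_and, Set.mem_ofPred_eq] at hq
      simp only [Finset.coe_filter, Finset.mem_Ioc, Set.mem_ofPred_eq]
      have h1 := ZMod.val_lt (q * (x : ZMod p))
      have h2 : (q * (x : ZMod p)).val ≠ 0 := by
        rw [Ne, ZMod.val_eq_zero]; exact mul_ne_zero hq.1 hx0
      exact ⟨⟨by omega, by omega⟩, hq.2⟩
    · intro q _ q' _ h
      exact mul_right_cancel₀ hx0 (ZMod.val_injective p h)
  have h1 := (Finset.card_le_card hsub).trans (Finset.card_biUnion_le_card_mul _ _ _ hcard)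
  rw [Finset.card_erase_of_mem (Finset.mem_univ _), Finset.card_univ, ZMod.card] at h1
  have h2 : (X.filter (· ≠ 0)).card ≤ X.card := Finset.card_filter_le _ _
  have h3 := Nat.div_mul_le_self (p - 1) N
  rcases Nat.eq_zero_or_pos ((p - 1) / N) with h | h
  · rw [h] at h1; omega
  · nlinarith

/-- **Ruzsa's model lemma**: a positive proportion of a set of integers is Freiman isomorphic of
order `m` to a subset of `ZMod N`, as soon as `N` exceeds the size of `mA - mA`. -/
theorem exists_freiman_model {A : Finset ℤ} {m N : ℕ} (hm : 0 < m)
    (hN : (m • A - m • A).card < N) :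
    ∃ A' ⊆ A, ∃ φ : ℤ → ZMod N, A.card ≤ m * A'.card ∧
      ∀ s t : Fin m → ℤ, (∀ i, s i ∈ A') → (∀ i, t i ∈ A') →
        (∑ i, φ (s i) = ∑ i, φ (t i) ↔ ∑ i, s i = ∑ i, t i) := by
  classical
  set X := m • A - m • A with hX
  obtain ⟨p, hpX, hp⟩ := Nat.exists_infinite_primes (∑ x ∈ X, x.natAbs + 1)
  have : Fact p.Prime := ⟨hp⟩
  have hp0 := hp.pos
  obtain ⟨q, hq⟩ := exists_dilation (p := p) X hN (by
    intro x hx hx0 h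
    rw [ZMod.intCast_zmod_eq_zero_iff_dvd] at h
    have h1 : x.natAbs ≤ ∑ x ∈ X, x.natAbs :=
      Finset.single_le_sum (f := fun x : ℤ => x.natAbs) (fun _ _ => Nat.zero_le _) hx
    exact hx0 (Int.eq_zero_of_abs_lt_dvd h (by rw [Int.abs_eq_natAbs]; omega)))
  set ψ : ℤ → ℕ := fun x => (q * (x : ZMod p)).val with hψ
  have hm' : (Finset.range m).Nonempty := ⟨0, by simpa using hm⟩
  obtain ⟨j, -, hj⟩ := Finset.exists_le_card_fiber_of_nsmul_le_card_of_maps_to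
    (s := A) (t := Finset.range m) (f := fun a => m * ψ a / p) (b := (A.card : ℚ) / m) (by
      intro a _
      rw [Finset.mem_range, Nat.div_lt_iff_lt_mul hp0]
      exact Nat.mul_lt_mul_of_pos_left (ZMod.val_lt _) hm) hm' (by
      have : (m : ℚ) ≠ 0 := by positivity
      rw [Finset.card_range, nsmul_eq_mul, mul_div_cancel₀ _ this])
  set A' := A.filter fun a => m * ψ a / p = j with hA'
  have hA'A : A' ⊆ A := Finset.filter_subset _ _
  refine ⟨A', hA'A, fun x => (ψ x : ZMod N), ?_, ?_⟩
  · rw [div_le_iff₀ (by positivity), mul_comm] at hj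
    exact_mod_cast hj
  have hclose : ∀ a ∈ A', ∀ b ∈ A', (m : ℤ) * (ψ a - ψ b) ≤ p - 1 := by
    intro a ha b hb
    have h1 := Nat.div_add_mod (m * ψ a) p
    have h2 := Nat.div_add_mod (m * ψ b) p
    rw [(Finset.mem_filter.1 ha).2] at h1
    rw [(Finset.mem_filter.1 hb).2] at h2
    have h3 := Nat.mod_lt (m * ψ a) hp0
    have h4 := Nat.mod_lt (m * ψ b) hp0
    rw [mul_sub]
    have h5 : ((m : ℤ) * ψ a) = (m * ψ a : ℕ) := by push_cast; rfl
    have h6 : ((m : ℤ) * ψ b) = (m * ψ b : ℕ) := by push_cast; rfl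
    rw [h5, h6]
    omega
  have hlt : ∀ s t : Fin m → ℤ, (∀ i, s i ∈ A') → (∀ i, t i ∈ A') →
      ∑ i, ((ψ (s i) : ℤ) - ψ (t i)) < p := by
    intro s t hs ht
    have h1 : (m : ℤ) * ∑ i, ((ψ (s i) : ℤ) - ψ (t i)) ≤ m * (p - 1) := by
      rw [Finset.mul_sum]
      refine (Finset.sum_le_sum fun i _ => hclose _ (hs i) _ (ht i)).trans_eq ?_
      rw [Finset.sum_const, Finset.card_univ, Fintype.card_fin, nsmul_eq_mul]
    have := le_of_mul_le_mul_left h1 (by exact_mod_cast hm)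
    omega
  have hmodp : ∀ s t : Fin m → ℤ, ((∑ i, ((ψ (s i) : ℤ) - ψ (t i)) : ℤ) : ZMod p) =
      q * ((∑ i, s i - ∑ i, t i : ℤ) : ZMod p) := by
    intro s t
    push_cast
    simp only [hψ, ZMod.natCast_val, ZMod.cast_id', id_eq]
    rw [Finset.sum_sub_distrib, mul_sub, Finset.mul_sum, Finset.mul_sum]
  have hmodN : ∀ s t : Fin m → ℤ, ((∑ i, ((ψ (s i) : ℤ) - ψ (t i)) : ℤ) : ZMod N) =
      ∑ i, (ψ (s i) : ZMod N) - ∑ i, (ψ (t i) : ZMod N) := by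
    intro s t
    push_cast
    rw [Finset.sum_sub_distrib]
  have hpos : ∀ s t : Fin m → ℤ, (∀ i, s i ∈ A') → (∀ i, t i ∈ A') →
      0 ≤ ∑ i, ((ψ (s i) : ℤ) - ψ (t i)) →
      ∑ i, (ψ (s i) : ZMod N) = ∑ i, (ψ (t i) : ZMod N) → ∑ i, s i = ∑ i, t i := by
    intro s t hs ht h0 h
    by_contra hne
    refine hq (∑ i, s i - ∑ i, t i) (Finset.sub_mem_sub
      (sum_fin_mem_nsmul fun i => hA'A (hs i)) (sum_fin_mem_nsmul fun i => hA'A (ht i)))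
      (sub_ne_zero.2 hne) ?_
    rw [← hmodp, ← Int.natCast_dvd_natCast, ZMod.val_intCast, Int.emod_eq_of_lt h0 (hlt s t hs ht),
      ← ZMod.intCast_zmod_eq_zero_iff_dvd, hmodN, h, sub_self]
  intro s t hs ht
  constructor
  · intro h
    rcases le_total 0 (∑ i, ((ψ (s i) : ℤ) - ψ (t i))) with h0 | h0
    · exact hpos s t hs ht h0 h
    · refine (hpos t s ht hs ?_ h.symm).symm
      rw [Finset.sum_sub_distrib] at h0 ⊢
      linarith
  · intro h
    have h1 := hmodp s t
    rw [h, sub_self, Int.cast_zero, mul_zero, ZMod.intCast_zmod_eq_zero_iff_dvd] at h1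
    have h2 := hlt s t hs ht
    have h3 := hlt t s ht hs
    have h4 : ∑ i, ((ψ (s i) : ℤ) - ψ (t i)) = 0 := by
      refine Int.eq_zero_of_abs_lt_dvd h1 (abs_lt.2 ⟨?_, h2⟩)
      rw [Finset.sum_sub_distrib] at h3 ⊢
      linarith
    have h5 := hmodN s t
    rw [h4, Int.cast_zero] at h5
    exact (sub_eq_zero.1 h5.symm)

/-- If `φ` is a Freiman isomorphism of order `6` from `A` to a subset `B` of `ZMod N`, a proper
progression in `2B - 2B` lifts to a proper progression in `2A - 2A`. -/
theorem lift_progression {N : ℕ} {A : Finset ℤ} {φ : ℤ → ZMod N}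
    (hφ : ∀ s t : Fin 6 → ℤ, (∀ i, s i ∈ A) → (∀ i, t i ∈ A) →
      (∑ i, φ (s i) = ∑ i, φ (t i) ↔ ∑ i, s i = ∑ i, t i))
    (hA : A.Nonempty) {D : ZMod N → Prop}
    (hD : ∀ y, D y → ∃ a ∈ A, ∃ b ∈ A, ∃ c ∈ A, ∃ d ∈ A, φ a + φ b - φ c - φ d = y)
    {k : ℕ} {x : Fin k → ZMod N} {M : Fin k → ℕ} (hM : ∀ i, 0 < M i) (hx : ∀ i, D (x i))
    (hbox : ∀ n : Fin k → ℕ, (∀ i, n i < M i) → D (∑ i, n i * x i))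
    (hinj : ∀ n n' : Fin k → ℕ, (∀ i, n i < M i) → (∀ i, n' i < M i) →
        ∑ i, n i * x i = ∑ i, n' i * x i → n = n') :
    ∃ u : Fin k → ℤ,
      (∀ n : Fin k → ℕ, (∀ i, n i < M i) → ∑ i, n i * u i ∈ 2 • A - 2 • A) ∧
      (∀ n n' : Fin k → ℕ, (∀ i, n i < M i) → (∀ i, n' i < M i) →
        ∑ i, n i * u i = ∑ i, n' i * u i → n = n') := by
  classical
  obtain ⟨e, he⟩ := hA
  choose! a ha b hb c hc d hd hy using hD
  set f : ZMod N → ℤ := fun y => a y + b y - c y - d y with hf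
  have hadd : ∀ y z, D y → D z → D (y + z) → f (y + z) = f y + f z := by
    intro y z h1 h2 h3
    have := (hφ ![a (y + z), b (y + z), c y, d y, c z, d z]
      ![c (y + z), d (y + z), a y, b y, a z, b z]
      (by simp [Fin.forall_fin_succ, *]) (by simp [Fin.forall_fin_succ, *])).1 (by
        simp [Fin.sum_univ_six]
        linear_combination hy _ h3 - hy _ h1 - hy _ h2)
    simp [Fin.sum_univ_six] at this
    simp only [hf]
    linarith
  have hfinj : ∀ y z, D y → D z → f y = f z → y = z := by
    intro y z h1 h2 h
    have := (hφ ![a y, b y, c z, d z, e, e] ![c y, d y, a z, b z, e, e]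
      (by simp [Fin.forall_fin_succ, *]) (by simp [Fin.forall_fin_succ, *])).2 (by
        simp only [hf] at h
        simp [Fin.sum_univ_six]
        linarith)
    simp [Fin.sum_univ_six] at this
    linear_combination this - hy _ h1 + hy _ h2
  have h0 : D 0 := by simpa using hbox 0 hM
  have hf0 : f 0 = 0 := by
    have := hadd 0 0 h0 h0 (by simpa using h0)
    simpa using this
  have hlin : ∀ (w : ℕ) (n : Fin k → ℕ), ∑ i, n i = w → (∀ i, n i < M i) →
      f (∑ i, n i * x i) = ∑ i, n i * f (x i) := by
    intro w
    induction w with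
    | zero =>
      intro n hn _
      have : ∀ i, n i = 0 := by simpa using hn
      simp [this, hf0]
    | succ w ih =>
      intro n hn hnM
      obtain ⟨j, hj⟩ : ∃ j, n j ≠ 0 := by
        by_contra! h
        simp [h] at hn
      set n' := n - Pi.single j 1 with hn'
      have hsplit : n = n' + Pi.single j 1 := by
        funext i
        by_cases hij : i = j
        · subst hij; simp [hn']; omega
        · simp [hn', hij]
      have hn'M : ∀ i, n' i < M i := fun i => (Nat.sub_le _ _).trans_lt (hnM i)
      have hsum : ∀ {S : Type} [CommRing S] (g : Fin k → S),
          ∑ i, (n i : S) * g i = ∑ i, (n' i : S) * g i + g j := by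
        intro S _ g
        conv_lhs => rw [hsplit]
        simp [add_mul, Finset.sum_add_distrib, Pi.single_apply]
      have hw : ∑ i, n' i = w := by
        have : ∑ i, n i = ∑ i, n' i + 1 := by
          conv_lhs => rw [hsplit]
          simp [Finset.sum_add_distrib]
        omega
      have hDn := hbox n hnM
      rw [hsum] at hDn ⊢
      rw [hsum, hadd _ _ (hbox n' hn'M) (hx j) hDn, ih n' hw hn'M]
  refine ⟨fun i => f (x i), fun n hn => ?_, fun n n' hn hn' h => ?_⟩
  · rw [← hlin _ n rfl hn]
    have hDn := hbox n hn
    simp only [hf, two_nsmul]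
    rw [sub_sub]
    exact Finset.sub_mem_sub (Finset.add_mem_add (ha _ hDn) (hb _ hDn))
      (Finset.add_mem_add (hc _ hDn) (hd _ hDn))
  · rw [← hlin _ n rfl hn, ← hlin _ n' rfl hn'] at h
    exact hinj n n' hn hn' (hfinj _ _ (hbox n hn) (hbox n' hn') h)

theorem card_nsmul_sub_nsmul_le {A : Finset ℤ} (hA : A.Nonempty) {K : ℝ}
    (hK : ((A + A).card : ℝ) ≤ K * A.card) (m n : ℕ) :
    ((m • A - n • A).card : ℝ) ≤ K ^ (m + n) * A.card := by
  have h := Finset.pluennecke_ruzsa_inequality_nsmul_sub_nsmul_add hA A m n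
  have h1 : ((m • A - n • A).card : ℝ) ≤ ((A + A).card / A.card : ℝ) ^ (m + n) * A.card := by
    have h2 := (NNRat.cast_le (K := ℝ)).2 h
    push_cast at h2
    exact h2
  have h0 : (0 : ℝ) < A.card := by exact_mod_cast hA.card_pos
  refine h1.trans ?_
  gcongr
  rwa [div_le_iff₀ h0]

/-- The bound on the inverse density of the progression found in a Bohr set of rank `d`. -/
noncomputable def bohrConst (d : ℕ) : ℝ := 4 ^ d * ((3 ^ d) ^ (d + 1) * (d + 1) ^ d)

theorem bohrConst_mono {d e : ℕ} (h : d ≤ e) : bohrConst d ≤ bohrConst e := by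
  have h1 : (1 : ℝ) ≤ 3 ^ d := one_le_pow₀ (by norm_num)
  have h2 : (d : ℝ) ≤ e := by exact_mod_cast h
  have h3 : (3 : ℝ) ^ d ≤ 3 ^ e := pow_le_pow_right₀ (by norm_num) h
  unfold bohrConst
  gcongr ?_ * (?_ * ?_)
  · exact pow_le_pow_right₀ (by norm_num) h
  · calc ((3 : ℝ) ^ d) ^ (d + 1) ≤ (3 ^ d) ^ (e + 1) := pow_le_pow_right₀ h1 (by omega)
      _ ≤ _ := by gcongr
  · calc ((d : ℝ) + 1) ^ d ≤ (d + 1) ^ e :=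
        pow_le_pow_right₀ (by linarith [Nat.cast_nonneg (α := ℝ) d]) h
      _ ≤ _ := by gcongr

/-- A set of integers of small doubling has a large proper progression in `2A - 2A`. -/
theorem exists_large_proper_progression {A : Finset ℤ} (hA : A.Nonempty) {K : ℝ} (hK1 : 1 ≤ K)
    (hK : ((A + A).card : ℝ) ≤ K * A.card) {d : ℕ} (hd : 2 * (30 * K ^ 12) ^ 2 + 1 ≤ (d : ℝ)) :
    ∃ (k : ℕ) (u : Fin k → ℤ) (M : Fin k → ℕ), k ≤ d ∧ (∀ i, 0 < M i) ∧
      (∀ n : Fin k → ℕ, (∀ i, n i < M i) → ∑ i, n i * u i ∈ 2 • A - 2 • A) ∧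
      (∀ n n' : Fin k → ℕ, (∀ i, n i < M i) → (∀ i, n' i < M i) →
        ∑ i, n i * u i = ∑ i, n' i * u i → n = n') ∧
      (A.card : ℝ) ≤ 6 * bohrConst d * ∏ i, (M i : ℝ) := by
  classical
  have hA0 : (1 : ℝ) ≤ A.card := by exact_mod_cast hA.card_pos
  set N := (6 • A - 6 • A).card + 4 with hN
  have : NeZero N := ⟨by omega⟩
  obtain ⟨A', hA'A, φ, hcard, hφ⟩ := exists_freiman_model (A := A) (m := 6) (N := N) (by norm_num)
    (by omega)
  have hcard' : (A.card : ℝ) ≤ 6 * A'.card := by exact_mod_cast hcard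
  have hA' : A'.Nonempty := by
    rw [← Finset.card_pos]
    have := hA.card_pos
    omega
  have hφinj : Set.InjOn φ A' := by
    intro a ha b hb h
    have := (hφ (fun _ => a) (fun _ => b) (fun _ => ha) (fun _ => hb)).1 (by simp [h])
    simpa using this
  have hBcard : (A'.image φ).card = A'.card := Finset.card_image_of_injOn hφinj
  have hNle : (N : ℝ) ≤ 30 * K ^ 12 * (A'.image φ).card := by
    have h1 := card_nsmul_sub_nsmul_le hA hK 6 6
    have h2 : (1 : ℝ) ≤ K ^ 12 := one_le_pow₀ hK1
    rw [hBcard, hN]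
    push_cast
    norm_num at h1
    nlinarith
  obtain ⟨R, hR1, hRcard, hR⟩ := bogolyubov (A'.image φ) (hA'.image φ) hNle
  have hRd : R.card ≤ d := by exact_mod_cast hRcard.trans hd
  obtain ⟨k, x, M, hk, hM, hx, hbox, hinj, hvol⟩ :=
    exists_proper_progression_of_isBohr R (by omega) hR1
  obtain ⟨u, hu, huinj⟩ := lift_progression (D := IsBohr R) hφ hA' (fun y hy => by
    obtain ⟨a, ha, b, hb, c, hc, e, he, h⟩ := hR y hy
    rw [Finset.mem_image] at ha hb hc he
    obtain ⟨a, ha, rfl⟩ := ha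
    obtain ⟨b, hb, rfl⟩ := hb
    obtain ⟨c, hc, rfl⟩ := hc
    obtain ⟨e, he, rfl⟩ := he
    exact ⟨a, ha, b, hb, c, hc, e, he, h⟩) hM hx hbox hinj
  refine ⟨k, u, M, hk.trans hRd, hM, fun n hn => ?_, huinj, ?_⟩
  · exact Finset.sub_subset_sub (Finset.nsmul_subset_nsmul_left hA'A)
      (Finset.nsmul_subset_nsmul_left hA'A) (hu n hn)
  · have h1 : ((A'.image φ).card : ℝ) ≤ N := by
      exact_mod_cast (Finset.card_le_univ _).trans_eq (ZMod.card N)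
    rw [hBcard] at h1
    have h2 : (N : ℝ) ≤ bohrConst d * ∏ i, (M i : ℝ) :=
      hvol.trans (mul_le_mul_of_nonneg_right (bohrConst_mono hRd)
        (Finset.prod_nonneg fun _ _ => Nat.cast_nonneg _))
    linarith

/-- A set covered by translates of the difference set of a progression lies in a single
progression. -/
theorem exists_progression_of_covering {A F : Finset ℤ} {k : ℕ} {u : Fin k → ℤ} {M : Fin k → ℕ}
    (hM : ∀ i, 0 < M i)
    (hcov : ∀ a ∈ A, ∃ s ∈ F, ∃ n n' : Fin k → ℕ, (∀ i, n i < M i) ∧ (∀ i, n' i < M i) ∧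
      a = s + (∑ i, n i * u i - ∑ i, n' i * u i)) :
    ∃ (h₀ : ℤ) (v : Fin (F.card + k) → ℤ) (L : Fin (F.card + k) → ℕ), (∀ i, 0 < L i) ∧
      (∀ a ∈ A, ∃ n : Fin (F.card + k) → ℤ,
        (∀ i, 0 ≤ n i ∧ n i < L i) ∧ a = h₀ + ∑ i, n i * v i) ∧
      ∏ i, L i ≤ 2 ^ (F.card + k) * ∏ i, M i := by
  classical
  let g : Fin F.card → ℤ := fun i => F.equivFin.symm i
  refine ⟨-∑ i, (M i - 1 : ℤ) * u i, Fin.append g u,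
    Fin.append (fun _ => 2) (fun i => 2 * M i - 1), ?_, ?_, ?_⟩
  · intro i
    refine Fin.addCases (fun j => ?_) (fun j => ?_) i
    · simp
    · have := hM j
      simp only [Fin.append_right]
      omega
  · intro a ha
    obtain ⟨s, hs, n, n', hn, hn', rfl⟩ := hcov a ha
    refine ⟨Fin.append (Pi.single (F.equivFin ⟨s, hs⟩) 1)
      (fun i => (n i : ℤ) - n' i + (M i - 1)), ?_, ?_⟩
    · intro i
      refine Fin.addCases (fun j => ?_) (fun j => ?_) i
      · simp only [Fin.append_left, Pi.single_apply]
        split_ifs <;> simp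
      · have h1 := hn j
        have h2 := hn' j
        simp only [Fin.append_right]
        omega
    · rw [Fin.sum_univ_add]
      simp only [Fin.append_left, Fin.append_right, Pi.single_apply, ite_mul, one_mul, zero_mul,
        Finset.sum_ite_eq', Finset.mem_univ, if_true, g, Equiv.symm_apply_apply, add_mul, sub_mul,
        Finset.sum_add_distrib, Finset.sum_sub_distrib]
      ring
  · rw [Fin.prod_univ_add, pow_add, mul_assoc]
    simp only [Fin.append_left, Fin.append_right, Finset.prod_const, Finset.card_univ,
      Fintype.card_fin]
    gcongr
    calc ∏ i, (2 * M i - 1) ≤ ∏ i, (2 * M i) := Finset.prod_le_prod' fun i _ => Nat.sub_le _ _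
      _ = _ := by rw [Finset.prod_mul_distrib]; simp

/-- Freiman's theorem: a finite set of integers with doubling at most `K` is contained
in a generalised arithmetic progression of rank `O_K(1)` and volume `O_K(|A|)`. -/
theorem freiman_theorem (K : ℝ) (hK : 1 ≤ K) :
    ∃ C : ℝ, 1 ≤ C ∧
      ∀ A : Finset ℤ, A.Nonempty → ((A + A).card : ℝ) ≤ K * A.card →
        ∃ (r : ℕ) (h₀ : ℤ) (u : Fin r → ℤ) (N : Fin r → ℕ),
          (r : ℝ) ≤ C ∧ (∀ i, 0 < N i) ∧
          (∀ a ∈ A, ∃ n : Fin r → ℤ,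
            (∀ i, 0 ≤ n i ∧ n i < N i) ∧ a = h₀ + ∑ i, n i * u i) ∧
          ((∏ i, N i : ℕ) : ℝ) ≤ C * A.card := by
  classical
  obtain ⟨d, hd⟩ := exists_nat_ge (2 * (30 * K ^ 12) ^ 2 + 1)
  obtain ⟨e, he⟩ := exists_nat_ge (K ^ 5 * (6 * bohrConst d))
  have hpow : (1 : ℝ) ≤ 2 ^ (e + d) * K ^ 4 :=
    one_le_mul_of_one_le_of_one_le (one_le_pow₀ (by norm_num)) (one_le_pow₀ hK)
  refine ⟨(e + d : ℕ) + 2 ^ (e + d) * K ^ 4, by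
    linarith [Nat.cast_nonneg (α := ℝ) (e + d)], fun A hA hAK => ?_⟩
  obtain ⟨k, u, M, hk, hM, hu, hinj, hvol⟩ := exists_large_proper_progression hA hK hAK hd
  set box := Fintype.piFinset fun i => Finset.range (M i) with hbox
  have hmem : ∀ n, n ∈ box ↔ ∀ i, n i < M i := by simp [hbox, Fintype.mem_piFinset]
  set P : Finset ℤ := box.image fun n => ∑ i, n i * u i with hP
  have hPcard : P.card = ∏ i, M i := by
    rw [hP, Finset.card_image_of_injOn, hbox, Fintype.card_piFinset]
    · simp
    · intro n hn n' hn' h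
      exact hinj n n' ((hmem n).1 hn) ((hmem n').1 hn') h
  have hPsub : P ⊆ 2 • A - 2 • A := by
    intro z hz
    obtain ⟨n, hn, rfl⟩ := Finset.mem_image.1 hz
    exact hu n ((hmem n).1 hn)
  have hPne : P.Nonempty := by
    rw [← Finset.card_pos, hPcard]
    exact Finset.prod_pos fun i _ => hM i
  have hPle : ((∏ i, M i : ℕ) : ℝ) ≤ K ^ 4 * A.card := by
    rw [← hPcard]
    exact (Nat.cast_le.2 (Finset.card_le_card hPsub)).trans (card_nsmul_sub_nsmul_le hA hAK 2 2)
  have hAP : ((A + P).card : ℝ) ≤ e * P.card := by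
    have hsub : A + P ⊆ 3 • A - 2 • A := by
      refine (Finset.add_subset_add_left hPsub).trans_eq ?_
      rw [← add_sub_assoc, ← succ_nsmul']
    calc ((A + P).card : ℝ) ≤ (3 • A - 2 • A).card := by
          exact_mod_cast Finset.card_le_card hsub
      _ ≤ K ^ 5 * A.card := card_nsmul_sub_nsmul_le hA hAK 3 2
      _ ≤ K ^ 5 * (6 * bohrConst d * P.card) := by
          rw [hPcard]
          push_cast
          gcongr
      _ = K ^ 5 * (6 * bohrConst d) * P.card := by ring
      _ ≤ e * P.card := by gcongr
  obtain ⟨F, -, hFcard, hcov⟩ := Finset.ruzsa_covering_add hPne hAP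
  have hFe : F.card ≤ e := by exact_mod_cast hFcard
  obtain ⟨h₀, v, L, hL, hAL, hLvol⟩ := exists_progression_of_covering (A := A) (F := F) hM
    fun a ha => by
      obtain ⟨s, hs, t, ht, rfl⟩ := Finset.mem_add.1 (hcov ha)
      obtain ⟨y, hy, z, hz, rfl⟩ := Finset.mem_sub.1 ht
      obtain ⟨n, hn, rfl⟩ := Finset.mem_image.1 hy
      obtain ⟨n', hn', rfl⟩ := Finset.mem_image.1 hz
      exact ⟨s, hs, n, n', (hmem n).1 hn, (hmem n').1 hn', rfl⟩
  have hrank : F.card + k ≤ e + d := add_le_add hFe hk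
  refine ⟨F.card + k, h₀, v, L, ?_, hL, hAL, ?_⟩
  · have : ((F.card + k : ℕ) : ℝ) ≤ (e + d : ℕ) := by exact_mod_cast hrank
    linarith
  · calc ((∏ i, L i : ℕ) : ℝ) ≤ 2 ^ (F.card + k) * (∏ i, M i : ℕ) := by exact_mod_cast hLvol
      _ ≤ 2 ^ (e + d) * (K ^ 4 * A.card) := by
          gcongr
          norm_num
      _ = 2 ^ (e + d) * K ^ 4 * A.card := by ring
      _ ≤ _ := by
          gcongr
          linarith [Nat.cast_nonneg (α := ℝ) (e + d)]
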